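/- Let V be a separable Banach space and let M ⊂ V* be a set of continuous linear functionals that is linearly independent, separates the points of V, and is fundamental with respect to the weak*-topology (i.e. its linear span is weak*-dense in V*). Let X = (X_m)_{m∈M} be a stochastic process on a probability space (Ω,𝓕,ℙ) with values in ℝ^M such that, almost surely, (X_m)_{m∈M} lies in the range of the embedding V → ℝ^M, v ↦ (m(v))_{m∈M}. Then there exist a set Ω̃ ⊆ Ω of full probability and a Borel-measurable random variable X̃ : Ω → V such that m(X̃(ω)) = X_m(ω) for all m ∈ M and all ω ∈ Ω̃. -/

import Mathlib

open MeasureTheory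

/-- A family of continuous maps separating the points of a second countable space has a countable
subfamily that separates points. -/
theorem exists_countable_separating_subfamily {ι α β : Type*} [TopologicalSpace α]
    [SecondCountableTopology α] [TopologicalSpace β] [T2Space β] (f : ι → α → β)
    (hf : ∀ i, Continuous (f i)) (hsep : ∀ v w : α, v ≠ w → ∃ i, f i v ≠ f i w) :
    ∃ T : Set ι, T.Countable ∧ Function.Injective fun (v : α) (i : T) => f i v := by
  obtain ⟨T, hT, hU⟩ := TopologicalSpace.isOpen_iUnion_countable
    (fun i => {p : α × α | f i p.1 ≠ f i p.2})
    (fun i => isOpen_ne_fun ((hf i).comp continuous_fst) ((hf i).comp continuous_snd))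
  refine ⟨T, hT, fun v w h => ?_⟩
  by_contra hne
  have hmem : (v, w) ∈ ⋃ i, {p : α × α | f i p.1 ≠ f i p.2} :=
    Set.mem_iUnion.2 (hsep v w hne)
  rw [← hU] at hmem
  obtain ⟨i, hi, hvw⟩ := Set.mem_iUnion₂.1 hmem
  exact hvw (congrFun h ⟨i, hi⟩)

/-- Let `V` be a separable Banach space and `M ⊂ V*` a linearly independent set of continuous
linear functionals that separates the points of `V` and whose linear span is dense in `V*`
with respect to the weak*-topology.  If `X = (X_m)_{m ∈ M}` is a stochastic process with
values in `ℝ^M` that lies, almost surely, in the range of the embedding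
`V → ℝ^M, v ↦ (m(v))_{m ∈ M}`, then there are a set `Ω̃ ⊆ Ω` of full probability and a
Borel-measurable random variable `X̃ : Ω → V` with `m(X̃(ω)) = X_m(ω)` for all `m ∈ M` and
all `ω ∈ Ω̃`. -/
theorem measurable_selection_of_embedded_process
    {V : Type*} [NormedAddCommGroup V] [NormedSpace ℝ V] [CompleteSpace V]
    [TopologicalSpace.SeparableSpace V] [MeasurableSpace V] [BorelSpace V]
    (M : Set (V →L[ℝ] ℝ))
    (hli : LinearIndependent ℝ ((↑) : M → V →L[ℝ] ℝ))
    (hsep : ∀ v w : V, v ≠ w → ∃ m ∈ M, m v ≠ m w)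
    (hfund : Dense (StrongDual.toWeakDual ''
      ((Submodule.span ℝ M : Submodule ℝ (V →L[ℝ] ℝ)) : Set (V →L[ℝ] ℝ))))
    {Ω : Type*} [MeasurableSpace Ω] (P : Measure Ω) [IsProbabilityMeasure P]
    (X : M → Ω → ℝ) (hX : ∀ m : M, Measurable (X m))
    (hrange : ∀ᵐ ω ∂P, ∃ v : V, ∀ m : M, (m : V →L[ℝ] ℝ) v = X m ω) :
    ∃ Ω' : Set Ω, P Ω' = 1 ∧
      ∃ X' : Ω → V, Measurable X' ∧
        ∀ m : M, ∀ ω ∈ Ω', (m : V →L[ℝ] ℝ) (X' ω) = X m ω := by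
  obtain ⟨T, hT, hinj⟩ := exists_countable_separating_subfamily
    (fun (m : M) (v : V) => (m : V →L[ℝ] ℝ) v) (fun m => (m : V →L[ℝ] ℝ).continuous)
    (fun v w h => by
      obtain ⟨m, hm, hne⟩ := hsep v w h
      exact ⟨⟨m, hm⟩, hne⟩)
  have : Countable T := hT.to_subtype
  have hcont : Continuous fun (v : V) (m : T) => (m : V →L[ℝ] ℝ) v :=
    continuous_pi fun m => (m : V →L[ℝ] ℝ).continuous
  obtain ⟨g, hg, hgT⟩ := (hcont.measurableEmbedding hinj).exists_measurable_extend
    measurable_id fun _ => ⟨(0 : V)⟩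
  refine ⟨{ω | ∃ v : V, ∀ m : M, (m : V →L[ℝ] ℝ) v = X m ω}, ?_,
    fun ω => g fun m : T => X m ω, hg.comp (measurable_pi_lambda _ fun m => hX m), ?_⟩
  · rw [measure_congr (Filter.eventuallyEq_univ.2 hrange), measure_univ]
  · rintro m ω ⟨v, hv⟩
    have hgv : g (fun m : T => X m ω) = v := by
      simpa only [Function.comp_apply, hv, id] using congrFun hgT v
    simp only [hgv, hv]
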